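/- There exists a constant C>0 such that for all finite words 𝔦∈𝓘* and all a,b∈[0,1]², the off-diagonal Jacobian entry satisfies |g_{𝔦,x}(a)/f_{𝔦,x}(b)| ≤ C. -/

import Mathlib

/-!
Setting (Falconer–Fraser–Lee, "L^q-spectra of measures on planar non-conformal attractors"):
a finite family of C^{1+α} skew-product contractions
`S i (x,y) = (f i x, g i (x,y))` of the unit square, satisfying a domination
condition on the (lower triangular) Jacobians.
-/

open Set Filter Topology MeasureTheory
open scoped Classical ENNReal

noncomputable section

/-- The closed unit square `[0,1]² ⊆ ℝ²`. -/
def unitSq : Set (ℝ × ℝ) := Set.Icc (0:ℝ) 1 ×ˢ Set.Icc (0:ℝ) 1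

variable {ι : Type*} [Fintype ι]

/-- The skew-product map `S_i(x,y) = (f_i x, g_i (x,y))`. -/
def Smap (f : ι → ℝ → ℝ) (g : ι → ℝ × ℝ → ℝ) (i : ι) : ℝ × ℝ → ℝ × ℝ :=
  fun a => (f i a.1, g i a)

/-- The composition `S_𝔦 = S_{i₁} ∘ ⋯ ∘ S_{i_k}` along a finite word `𝔦 = [i₁, …, i_k]`. -/
def Sword (f : ι → ℝ → ℝ) (g : ι → ℝ × ℝ → ℝ) : List ι → ℝ × ℝ → ℝ × ℝ
  | [] => id
  | i :: l => Smap f g i ∘ Sword f g l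

/-- The first component `f_𝔦 = f_{i₁} ∘ ⋯ ∘ f_{i_k}` of `S_𝔦` (a function of `x` only). -/
def fword (f : ι → ℝ → ℝ) : List ι → ℝ → ℝ
  | [] => id
  | i :: l => f i ∘ fword f l

/-- Top-left entry `f_{𝔦,x}(a)` of the (lower triangular) Jacobian `D_a S_𝔦`. -/
def fxw (f : ι → ℝ → ℝ) (g : ι → ℝ × ℝ → ℝ) (l : List ι) (a : ℝ × ℝ) : ℝ :=
  deriv (fun x => (Sword f g l (x, a.2)).1) a.1

/-- Bottom-left entry `g_{𝔦,x}(a)` of the Jacobian `D_a S_𝔦`. -/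
def gxw (f : ι → ℝ → ℝ) (g : ι → ℝ × ℝ → ℝ) (l : List ι) (a : ℝ × ℝ) : ℝ :=
  deriv (fun x => (Sword f g l (x, a.2)).2) a.1

/-- Bottom-right entry `g_{𝔦,y}(a)` of the Jacobian `D_a S_𝔦`. -/
def gyw (f : ι → ℝ → ℝ) (g : ι → ℝ × ℝ → ℝ) (l : List ι) (a : ℝ × ℝ) : ℝ :=
  deriv (fun y => (Sword f g l (a.1, y)).2) a.2

/-- The standing hypotheses: `|𝓘| ≥ 2`; each `S_i(x,y) = (f_i x, g_i(x,y))` maps the unit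
square into itself; `f_i, g_i` are `C^{1+α}` contractions (`0 < α ≤ 1`); and the
domination condition `inf f_{i,x} > sup g_{i,y} ≥ inf g_{i,y} ≥ d > 0` holds. -/
structure IFSHyp (f : ι → ℝ → ℝ) (g : ι → ℝ × ℝ → ℝ) (α d : ℝ) : Prop where
  card2 : 2 ≤ Fintype.card ι
  alpha_pos : 0 < α
  alpha_le_one : α ≤ 1
  d_pos : 0 < d
  maps_f : ∀ i, Set.MapsTo (f i) (Set.Icc 0 1) (Set.Icc 0 1)
  maps_g : ∀ i, Set.MapsTo (g i) unitSq (Set.Icc 0 1)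
  diff_f : ∀ i, Differentiable ℝ (f i)
  diff_g : ∀ i, Differentiable ℝ (g i)
  holder_f : ∀ i, ∃ H : ℝ, ∀ x ∈ Set.Icc (0:ℝ) 1, ∀ y ∈ Set.Icc (0:ℝ) 1,
      |deriv (f i) x - deriv (f i) y| ≤ H * |x - y| ^ α
  holder_g : ∀ i, ∃ H : ℝ, ∀ a ∈ unitSq, ∀ b ∈ unitSq,
      ‖fderiv ℝ (g i) a - fderiv ℝ (g i) b‖ ≤ H * ‖a - b‖ ^ α
  contr_f : ∀ i, ∃ c, 0 ≤ c ∧ c < 1 ∧ ∀ x ∈ Set.Icc (0:ℝ) 1, ∀ y ∈ Set.Icc (0:ℝ) 1,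
      |f i x - f i y| ≤ c * |x - y|
  contr_g : ∀ i, ∃ c, 0 ≤ c ∧ c < 1 ∧ ∀ a ∈ unitSq, ∀ b ∈ unitSq,
      |g i a - g i b| ≤ c * ‖a - b‖
  dom : ∀ i, sSup (gyw f g [i] '' unitSq) < sInf (fxw f g [i] '' unitSq)
  dom_d : ∀ i, ∀ a ∈ unitSq, d ≤ gyw f g [i] a

/-- The larger singular value of the lower triangular matrix `A = [[a,0],[b,c]]`, i.e. the
square root of the larger eigenvalue of `AᵀA`, in explicit closed form. -/
def sv1 (a b c : ℝ) : ℝ :=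
  Real.sqrt (((a ^ 2 + b ^ 2 + c ^ 2) +
    Real.sqrt ((a ^ 2 + b ^ 2 + c ^ 2) ^ 2 - 4 * (a * c) ^ 2)) / 2)

/-- The smaller singular value of the lower triangular matrix `A = [[a,0],[b,c]]`, i.e. the
square root of the smaller eigenvalue of `AᵀA`, in explicit closed form. -/
def sv2 (a b c : ℝ) : ℝ :=
  Real.sqrt (((a ^ 2 + b ^ 2 + c ^ 2) -
    Real.sqrt ((a ^ 2 + b ^ 2 + c ^ 2) ^ 2 - 4 * (a * c) ^ 2)) / 2)

/-- `α₁(D_a S_𝔦)`, the larger singular value of the Jacobian. -/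
def alphaOne (f : ι → ℝ → ℝ) (g : ι → ℝ × ℝ → ℝ) (l : List ι) (a : ℝ × ℝ) : ℝ :=
  sv1 (fxw f g l a) (gxw f g l a) (gyw f g l a)

/-- `α₂(D_a S_𝔦)`, the smaller singular value of the Jacobian. -/
def alphaTwo (f : ι → ℝ → ℝ) (g : ι → ℝ × ℝ → ℝ) (l : List ι) (a : ℝ × ℝ) : ℝ :=
  sv2 (fxw f g l a) (gxw f g l a) (gyw f g l a)

/-- `η = sup_{i, a, b} g_{i,y}(a) / f_{i,x}(b)`. -/
def etaSup (f : ι → ℝ → ℝ) (g : ι → ℝ × ℝ → ℝ) : ℝ :=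
  sSup {x : ℝ | ∃ i : ι, ∃ a ∈ unitSq, ∃ b ∈ unitSq, x = gyw f g [i] a / fxw f g [i] b}

/-- `p(𝔦) = p_{i₁} ⋯ p_{i_k}`. -/
def pword (p : ι → ℝ) (l : List ι) : ℝ := (l.map p).prod

/-- `(p_i)` is a probability vector with all entries in `(0,1)`. -/
def ProbVec (p : ι → ℝ) : Prop := (∀ i, 0 < p i ∧ p i < 1) ∧ ∑ i, p i = 1

/-- The `q`-modified singular value function
`ψ^{s,q}_a(𝔦) = p(𝔦)^q α₁(D_aS_𝔦)^βq α₂(D_aS_𝔦)^(s−βq)` (real exponents). -/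
def psiSV (f : ι → ℝ → ℝ) (g : ι → ℝ × ℝ → ℝ) (p : ι → ℝ) (s q βq : ℝ)
    (a : ℝ × ℝ) (l : List ι) : ℝ :=
  pword p l ^ q * alphaOne f g l a ^ βq * alphaTwo f g l a ^ (s - βq)

/-- `Ψ^{s,q}_{a,k} = Σ_{𝔦 ∈ 𝓘^k} ψ^{s,q}_a(𝔦)`. -/
def PsiSum (f : ι → ℝ → ℝ) (g : ι → ℝ × ℝ → ℝ) (p : ι → ℝ) (s q βq : ℝ)
    (a : ℝ × ℝ) (k : ℕ) : ℝ :=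
  ∑ w : Fin k → ι, psiSV f g p s q βq a (List.ofFn w)

/-- The `δ`-stopping `𝓘_{a,δ} = {𝔦 : α₂(D_aS_𝔦) < δ ≤ α₂(D_aS_𝔦̂)}`, where `𝔦̂` drops the
last letter of `𝔦`. -/
def stopping (f : ι → ℝ → ℝ) (g : ι → ℝ × ℝ → ℝ) (a : ℝ × ℝ) (δ : ℝ) : Set (List ι) :=
  {l | l ≠ [] ∧ alphaTwo f g l a < δ ∧ δ ≤ alphaTwo f g l.dropLast a}

/-- `q`-th power moment sum of a measure on `ℝ` over the `δ`-mesh intervals of positive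
measure. -/
def msum1 (ν : Measure ℝ) (q δ : ℝ) : ℝ :=
  ∑' k : ℤ, if 0 < ν (Set.Icc ((k : ℝ) * δ) (((k : ℝ) + 1) * δ)) then
    (ν (Set.Icc ((k : ℝ) * δ) (((k : ℝ) + 1) * δ))).toReal ^ q else 0

/-- `q`-th power moment sum of a measure on `ℝ²` over the `δ`-mesh squares of positive
measure. -/
def msum2 (ν : Measure (ℝ × ℝ)) (q δ : ℝ) : ℝ :=
  ∑' k : ℤ × ℤ,
    if 0 < ν (Set.Icc ((k.1 : ℝ) * δ) (((k.1 : ℝ) + 1) * δ) ×ˢ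
        Set.Icc ((k.2 : ℝ) * δ) (((k.2 : ℝ) + 1) * δ)) then
      (ν (Set.Icc ((k.1 : ℝ) * δ) (((k.1 : ℝ) + 1) * δ) ×ˢ
        Set.Icc ((k.2 : ℝ) * δ) (((k.2 : ℝ) + 1) * δ))).toReal ^ q else 0

/-- Upper `L^q`-spectrum of a measure on `ℝ²`. -/
def upperTau2 (ν : Measure (ℝ × ℝ)) (q : ℝ) : ℝ :=
  limsup (fun δ => Real.log (msum2 ν q δ) / (-Real.log δ)) (𝓝[>] (0:ℝ))

/-- Lower `L^q`-spectrum of a measure on `ℝ²`. -/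
def lowerTau2 (ν : Measure (ℝ × ℝ)) (q : ℝ) : ℝ :=
  liminf (fun δ => Real.log (msum2 ν q δ) / (-Real.log δ)) (𝓝[>] (0:ℝ))

section Jacobian

variable {κ : Type*} {f : κ → ℝ → ℝ} {g : κ → ℝ × ℝ → ℝ}

theorem Sword_fst (l : List κ) (a : ℝ × ℝ) : (Sword f g l a).1 = fword f l a.1 := by
  induction l with
  | nil => rfl
  | cons i l ih => simp [Sword, fword, Smap, ih]

theorem differentiable_fword (hf : ∀ i, Differentiable ℝ (f i)) (l : List κ) :
    Differentiable ℝ (fword f l) := by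
  induction l with
  | nil => exact differentiable_id
  | cons i l ih => exact (hf i).comp ih

theorem differentiable_Sword (hf : ∀ i, Differentiable ℝ (f i))
    (hg : ∀ i, Differentiable ℝ (g i)) (l : List κ) : Differentiable ℝ (Sword f g l) := by
  induction l with
  | nil => exact differentiable_id
  | cons i l ih =>
    have hS : Differentiable ℝ (Smap f g i) :=
      ((hf i).comp differentiable_fst).prodMk (hg i)
    exact hS.comp ih

theorem fxw_eq_deriv_fword (l : List κ) (a : ℝ × ℝ) :
    fxw f g l a = deriv (fword f l) a.1 := by
  simp only [fxw, Sword_fst]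

theorem fxw_nil (a : ℝ × ℝ) : fxw f g [] a = 1 := by
  simp [fxw, Sword]

theorem gxw_nil (a : ℝ × ℝ) : gxw f g [] a = 0 := by
  simp [gxw, Sword]

theorem fxw_singleton (i : κ) (a : ℝ × ℝ) : fxw f g [i] a = deriv (f i) a.1 := by
  simp [fxw_eq_deriv_fword, fword]

theorem gyw_singleton (hg : ∀ i, Differentiable ℝ (g i)) (i : κ) (a : ℝ × ℝ) :
    gyw f g [i] a = fderiv ℝ (g i) a (0, 1) := by
  have hcurve : HasDerivAt (fun y : ℝ => (a.1, y)) ((0 : ℝ), (1 : ℝ)) a.2 :=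
    (hasDerivAt_const a.2 a.1).prodMk (hasDerivAt_id a.2)
  exact ((hg i a).hasFDerivAt.comp_hasDerivAt a.2 hcurve).deriv

theorem fxw_cons (hf : ∀ i, Differentiable ℝ (f i)) (i : κ) (l : List κ) (a : ℝ × ℝ) :
    fxw f g (i :: l) a = deriv (f i) (fword f l a.1) * fxw f g l a := by
  simp only [fxw_eq_deriv_fword]
  exact deriv_comp _ (hf i _) (differentiable_fword hf l _)

theorem gxw_cons (hf : ∀ i, Differentiable ℝ (f i)) (hg : ∀ i, Differentiable ℝ (g i))
    (i : κ) (l : List κ) (a : ℝ × ℝ) :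
    gxw f g (i :: l) a = fxw f g l a * fderiv ℝ (g i) (Sword f g l a) (1, 0) +
      gxw f g l a * fderiv ℝ (g i) (Sword f g l a) (0, 1) := by
  have hcurve : Differentiable ℝ (fun x : ℝ => Sword f g l (x, a.2)) :=
    (differentiable_Sword hf hg l).comp (differentiable_id.prodMk (differentiable_const _))
  have hpair : HasDerivAt (fun x : ℝ => Sword f g l (x, a.2)) (fxw f g l a, gxw f g l a) a.1 :=
    ((hcurve.fst a.1).hasDerivAt).prodMk ((hcurve.snd a.1).hasDerivAt)
  have hcomp : gxw f g (i :: l) a =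
      fderiv ℝ (g i) (Sword f g l a) (fxw f g l a, gxw f g l a) :=
    ((hg i _).hasFDerivAt.comp_hasDerivAt a.1 hpair).deriv
  have hsplit : (fxw f g l a, gxw f g l a) =
      fxw f g l a • ((1 : ℝ), (0 : ℝ)) + gxw f g l a • ((0 : ℝ), (1 : ℝ)) := by simp
  rw [hcomp, hsplit, map_add, map_smul, map_smul, smul_eq_mul, smul_eq_mul]

theorem mapsTo_fword (hf : ∀ i, MapsTo (f i) (Icc 0 1) (Icc 0 1)) (l : List κ) :
    MapsTo (fword f l) (Icc 0 1) (Icc 0 1) := by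
  induction l with
  | nil => exact mapsTo_id _
  | cons i l ih => exact (hf i).comp ih

theorem mapsTo_Sword (hf : ∀ i, MapsTo (f i) (Icc 0 1) (Icc 0 1))
    (hg : ∀ i, MapsTo (g i) unitSq (Icc 0 1)) (l : List κ) :
    MapsTo (Sword f g l) unitSq unitSq := by
  induction l with
  | nil => exact mapsTo_id _
  | cons i l ih =>
    have hS : MapsTo (Smap f g i) unitSq unitSq := fun a ha => ⟨hf i ha.1, hg i ha⟩
    exact hS.comp ih

theorem abs_fword_sub_le {c : ℝ} (hc : 0 ≤ c)
    (hf : ∀ i, MapsTo (f i) (Icc 0 1) (Icc 0 1))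
    (hcontr : ∀ i, ∀ x ∈ Icc (0 : ℝ) 1, ∀ y ∈ Icc (0 : ℝ) 1, |f i x - f i y| ≤ c * |x - y|)
    (l : List κ) {x y : ℝ} (hx : x ∈ Icc (0 : ℝ) 1) (hy : y ∈ Icc (0 : ℝ) 1) :
    |fword f l x - fword f l y| ≤ c ^ l.length := by
  induction l with
  | nil =>
    have := abs_sub_le_of_le_of_le hx.1 hx.2 hy.1 hy.2
    simpa [fword] using this
  | cons i l ih =>
    calc |fword f (i :: l) x - fword f (i :: l) y|
        ≤ c * |fword f l x - fword f l y| :=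
          hcontr i _ (mapsTo_fword hf l hx) _ (mapsTo_fword hf l hy)
      _ ≤ c * c ^ l.length := by gcongr
      _ = c ^ (i :: l).length := by rw [List.length_cons, pow_succ']

theorem fxw_pos {m : ℝ} (hm : 0 < m) (hdiff : ∀ i, Differentiable ℝ (f i))
    (hf : ∀ i, MapsTo (f i) (Icc 0 1) (Icc 0 1))
    (hlow : ∀ i, ∀ x ∈ Icc (0 : ℝ) 1, m ≤ deriv (f i) x)
    (l : List κ) {a : ℝ × ℝ} (ha : a ∈ unitSq) : 0 < fxw f g l a := by
  induction l with
  | nil => simp [fxw_nil]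
  | cons i l ih =>
    rw [fxw_cons hdiff]
    exact mul_pos (hm.trans_le (hlow i _ (mapsTo_fword hf l ha.1))) ih

/-- Bounded distortion of the top-left Jacobian entry. -/
theorem fxw_le_exp_mul_fxw {m c H α : ℝ} (hm : 0 < m) (hc0 : 0 ≤ c) (hc1 : c < 1)
    (hH : 0 ≤ H) (hα : 0 < α) (hdiff : ∀ i, Differentiable ℝ (f i))
    (hf : ∀ i, MapsTo (f i) (Icc 0 1) (Icc 0 1))
    (hlow : ∀ i, ∀ x ∈ Icc (0 : ℝ) 1, m ≤ deriv (f i) x)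
    (hcontr : ∀ i, ∀ x ∈ Icc (0 : ℝ) 1, ∀ y ∈ Icc (0 : ℝ) 1, |f i x - f i y| ≤ c * |x - y|)
    (hholder : ∀ i, ∀ x ∈ Icc (0 : ℝ) 1, ∀ y ∈ Icc (0 : ℝ) 1,
      |deriv (f i) x - deriv (f i) y| ≤ H * |x - y| ^ α)
    (l : List κ) {a b : ℝ × ℝ} (ha : a ∈ unitSq) (hb : b ∈ unitSq) :
    fxw f g l a ≤ Real.exp (H / m * (1 - c ^ α)⁻¹) * fxw f g l b := by
  have hρ0 : 0 ≤ c ^ α := Real.rpow_nonneg hc0 α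
  have hρ1 : c ^ α < 1 := Real.rpow_lt_one hc0 hc1 hα
  have key : fxw f g l a ≤
      Real.exp (H / m * ∑ k ∈ Finset.range l.length, (c ^ α) ^ k) * fxw f g l b := by
    induction l with
    | nil => simp [fxw_nil]
    | cons i l ih =>
      set u := fword f l a.1
      set v := fword f l b.1
      have hu : u ∈ Icc (0 : ℝ) 1 := mapsTo_fword hf l ha.1
      have hv : v ∈ Icc (0 : ℝ) 1 := mapsTo_fword hf l hb.1
      have hpow : |u - v| ^ α ≤ (c ^ α) ^ l.length := by
        rw [Real.rpow_pow_comm hc0]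
        exact Real.rpow_le_rpow (abs_nonneg _) (abs_fword_sub_le hc0 hf hcontr l ha.1 hb.1) hα.le
      have hmv := hlow i v hv
      have hmain : deriv (f i) u ≤
          Real.exp (H / m * (c ^ α) ^ l.length) * deriv (f i) v :=
        calc deriv (f i) u ≤ H * |u - v| ^ α + deriv (f i) v := by
              linarith [le_abs_self (deriv (f i) u - deriv (f i) v), hholder i u hu v hv]
          _ ≤ H * (c ^ α) ^ l.length + deriv (f i) v := by gcongr
          _ = H / m * (c ^ α) ^ l.length * m + deriv (f i) v := by field_simp
          _ ≤ H / m * (c ^ α) ^ l.length * deriv (f i) v + deriv (f i) v := by gcongr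
          _ = (H / m * (c ^ α) ^ l.length + 1) * deriv (f i) v := by ring
          _ ≤ _ := mul_le_mul_of_nonneg_right (Real.add_one_le_exp _) (hm.le.trans hmv)
      rw [fxw_cons hdiff, fxw_cons hdiff, List.length_cons, Finset.sum_range_succ, mul_add,
        Real.exp_add]
      calc deriv (f i) u * fxw f g l a
          ≤ (Real.exp (H / m * (c ^ α) ^ l.length) * deriv (f i) v) *
            (Real.exp (H / m * ∑ k ∈ Finset.range l.length, (c ^ α) ^ k) * fxw f g l b) :=
            mul_le_mul hmain ih (fxw_pos hm hdiff hf hlow l ha).le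
              (mul_nonneg (Real.exp_pos _).le (hm.le.trans hmv))
        _ = _ := by ring
  refine key.trans (mul_le_mul_of_nonneg_right (Real.exp_le_exp.2 ?_)
    (fxw_pos hm hdiff hf hlow l hb).le)
  gcongr
  rw [← tsum_geometric_of_lt_one hρ0 hρ1]
  exact (summable_geometric_of_lt_one hρ0 hρ1).sum_le_tsum _ fun k _ => pow_nonneg hρ0 k

/-- At a single point, domination bounds the off-diagonal entry by the top-left one. -/
theorem abs_gxw_le_mul_fxw {m M η : ℝ} (hm : 0 < m) (hη1 : η < 1) (hM0 : 0 ≤ M)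
    (hdiff : ∀ i, Differentiable ℝ (f i)) (hdiffg : ∀ i, Differentiable ℝ (g i))
    (hf : ∀ i, MapsTo (f i) (Icc 0 1) (Icc 0 1)) (hg : ∀ i, MapsTo (g i) unitSq (Icc 0 1))
    (hlow : ∀ i, ∀ x ∈ Icc (0 : ℝ) 1, m ≤ deriv (f i) x)
    (hM : ∀ i, ∀ a ∈ unitSq, |fderiv ℝ (g i) a (1, 0)| ≤ M)
    (hη : ∀ i, ∀ a ∈ unitSq, |fderiv ℝ (g i) a (0, 1)| ≤ η * deriv (f i) a.1)
    (l : List κ) {a : ℝ × ℝ} (ha : a ∈ unitSq) :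
    |gxw f g l a| ≤ M / m / (1 - η) * fxw f g l a := by
  have hgap : 0 < 1 - η := sub_pos.2 hη1
  induction l with
  | nil =>
    rw [gxw_nil, fxw_nil, abs_zero]
    positivity
  | cons i l ih =>
    have hpos := fxw_pos (g := g) hm hdiff hf hlow l ha
    have hS := mapsTo_Sword hf hg l ha
    have hx := hM i _ hS
    have hy := hη i _ hS
    have hlo := hlow i _ (mapsTo_fword hf l ha.1)
    rw [Sword_fst] at hy
    rw [gxw_cons hdiff hdiffg, fxw_cons hdiff]
    set F := fxw f g l a
    set D := deriv (f i) (fword f l a.1)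
    calc _ ≤ F * |fderiv ℝ (g i) (Sword f g l a) (1, 0)| +
          |gxw f g l a| * |fderiv ℝ (g i) (Sword f g l a) (0, 1)| := by
            refine (abs_add_le _ _).trans_eq ?_
            rw [abs_mul, abs_mul, abs_of_pos hpos]
      _ ≤ F * M + M / m / (1 - η) * F * (η * D) := by gcongr
      _ = M / m * m * F + M / m / (1 - η) * F * (η * D) := by
          rw [div_mul_cancel₀ _ hm.ne']; ring
      _ ≤ M / m * D * F + M / m / (1 - η) * F * (η * D) := by gcongr
      _ = M / m / (1 - η) * (D * F) := by field_simp; ring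

end Jacobian

theorem norm_le_of_holder {X E : Type*} [SeminormedAddCommGroup X] [SeminormedAddCommGroup E]
    {φ : X → E} {s : Set X} {H α : ℝ} {p : X} (hα : 0 < α) (hp : p ∈ s)
    (hs : ∀ a ∈ s, ‖a - p‖ ≤ 1)
    (hφ : ∀ a ∈ s, ∀ b ∈ s, ‖φ a - φ b‖ ≤ H * ‖a - b‖ ^ α) {a : X} (ha : a ∈ s) :
    ‖φ a‖ ≤ ‖φ p‖ + |H| := by
  have hpow : ‖a - p‖ ^ α ≤ 1 := Real.rpow_le_one (norm_nonneg _) (hs a ha) hα.le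
  have hle : H * ‖a - p‖ ^ α ≤ |H| :=
    (mul_le_mul_of_nonneg_right (le_abs_self H) (Real.rpow_nonneg (norm_nonneg _) _)).trans
      (mul_le_of_le_one_right (abs_nonneg H) hpow)
  have htri := norm_add_le (φ p) (φ a - φ p)
  rw [add_sub_cancel] at htri
  linarith [hφ a ha p hp]

theorem zero_mem_unitSq : (0 : ℝ × ℝ) ∈ unitSq :=
  ⟨left_mem_Icc.2 zero_le_one, left_mem_Icc.2 zero_le_one⟩

theorem abs_fderiv_apply_le {φ : ℝ × ℝ → ℝ} {a v : ℝ × ℝ} {M : ℝ} (hM : ‖fderiv ℝ φ a‖ ≤ M)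
    (hv : ‖v‖ ≤ 1) : |fderiv ℝ φ a v| ≤ M :=
  ((fderiv ℝ φ a).unit_le_opNorm v hv).trans hM

namespace IFSHyp

variable {κ : Type*} [Fintype κ] {f : κ → ℝ → ℝ} {g : κ → ℝ × ℝ → ℝ} {α d : ℝ}

theorem exists_norm_fderiv_le (h : IFSHyp f g α d) (i : κ) :
    ∃ M, ∀ a ∈ unitSq, ‖fderiv ℝ (g i) a‖ ≤ M := by
  obtain ⟨H, hH⟩ := h.holder_g i
  refine ⟨_, fun a ha => norm_le_of_holder h.alpha_pos zero_mem_unitSq (fun b hb => ?_) hH ha⟩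
  rw [sub_zero, Prod.norm_def]
  exact max_le (abs_le.2 ⟨by linarith [hb.1.1], hb.1.2⟩) (abs_le.2 ⟨by linarith [hb.2.1], hb.2.2⟩)

theorem exists_abs_deriv_le (h : IFSHyp f g α d) (i : κ) :
    ∃ M, ∀ x ∈ Icc (0 : ℝ) 1, |deriv (f i) x| ≤ M := by
  obtain ⟨H, hH⟩ := h.holder_f i
  refine ⟨_, fun x hx => norm_le_of_holder (φ := deriv (f i)) (p := 0) h.alpha_pos (by simp)
    (fun y hy => ?_) hH hx⟩
  rw [sub_zero]
  exact abs_le.2 ⟨by linarith [hy.1], hy.2⟩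

/-- The domination condition without the junk values of `sSup` and `sInf`. -/
theorem exists_domination (h : IFSHyp f g α d) (i : κ) :
    ∃ s t : ℝ, d ≤ s ∧ s < t ∧ (∀ a ∈ unitSq, fderiv ℝ (g i) a (0, 1) ≤ s) ∧
      ∀ x ∈ Icc (0 : ℝ) 1, t ≤ deriv (f i) x := by
  obtain ⟨M, hM⟩ := h.exists_norm_fderiv_le i
  obtain ⟨N, hN⟩ := h.exists_abs_deriv_le i
  have habove : BddAbove (gyw f g [i] '' unitSq) := by
    refine ⟨M, forall_mem_image.2 fun a ha => ?_⟩
    rw [gyw_singleton h.diff_g]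
    exact (le_abs_self _).trans (abs_fderiv_apply_le (hM a ha) (by simp [Prod.norm_def]))
  have hbelow : BddBelow (fxw f g [i] '' unitSq) := by
    refine ⟨-N, forall_mem_image.2 fun a ha => ?_⟩
    rw [fxw_singleton]
    exact (abs_le.1 (hN _ ha.1)).1
  have hle : ∀ a ∈ unitSq, gyw f g [i] a ≤ sSup (gyw f g [i] '' unitSq) :=
    fun a ha => le_csSup habove (mem_image_of_mem _ ha)
  refine ⟨_, _, (h.dom_d i 0 zero_mem_unitSq).trans (hle 0 zero_mem_unitSq), h.dom i,
    fun a ha => ?_, fun x hx => ?_⟩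
  · rw [← gyw_singleton (f := f) h.diff_g]
    exact hle a ha
  · have hmem : (x, (0 : ℝ)) ∈ unitSq := ⟨hx, by simp⟩
    have := csInf_le hbelow (mem_image_of_mem _ hmem)
    rwa [fxw_singleton] at this

theorem le_deriv (h : IFSHyp f g α d) (i : κ) {x : ℝ} (hx : x ∈ Icc (0 : ℝ) 1) :
    d ≤ deriv (f i) x := by
  obtain ⟨s, t, hds, hst, -, ht⟩ := h.exists_domination i
  exact (hds.trans hst.le).trans (ht x hx)

theorem exists_uniform_domination (h : IFSHyp f g α d) :
    ∃ η < 1, ∀ i, ∀ a ∈ unitSq,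
      |fderiv ℝ (g i) a (0, 1)| ≤ η * deriv (f i) a.1 := by
  have hev : ∀ i, ∀ᶠ η in 𝓝[<] (1 : ℝ), ∀ a ∈ unitSq,
      |fderiv ℝ (g i) a (0, 1)| ≤ η * deriv (f i) a.1 := by
    intro i
    obtain ⟨s, t, hds, hst, hs, ht⟩ := h.exists_domination i
    have hs0 : 0 < s := h.d_pos.trans_le hds
    have ht0 : 0 < t := hs0.trans hst
    filter_upwards [Ioo_mem_nhdsLT ((div_lt_one ht0).2 hst)] with η hη a ha
    have hη0 : 0 ≤ η := (div_pos hs0 ht0).le.trans hη.1.le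
    have hnn : 0 ≤ fderiv ℝ (g i) a (0, 1) := by
      rw [← gyw_singleton (f := f) h.diff_g]
      exact h.d_pos.le.trans (h.dom_d i a ha)
    rw [abs_of_nonneg hnn]
    calc fderiv ℝ (g i) a (0, 1) ≤ s := hs a ha
      _ ≤ η * t := ((div_lt_iff₀ ht0).1 hη.1).le
      _ ≤ η * deriv (f i) a.1 := by gcongr; exact ht _ ha.1
  obtain ⟨η, hη, hmem⟩ := ((eventually_all.2 hev).and self_mem_nhdsWithin).exists
  exact ⟨η, hmem, hη⟩

theorem exists_uniform_contraction (h : IFSHyp f g α d) :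
    ∃ c, 0 ≤ c ∧ c < 1 ∧ ∀ i, ∀ x ∈ Icc (0 : ℝ) 1, ∀ y ∈ Icc (0 : ℝ) 1,
      |f i x - f i y| ≤ c * |x - y| := by
  have hev : ∀ i, ∀ᶠ c in 𝓝[<] (1 : ℝ), ∀ x ∈ Icc (0 : ℝ) 1, ∀ y ∈ Icc (0 : ℝ) 1,
      |f i x - f i y| ≤ c * |x - y| := by
    intro i
    obtain ⟨c₀, -, hc₀, hcontr⟩ := h.contr_f i
    filter_upwards [Ioo_mem_nhdsLT hc₀] with c hc x hx y hy
    exact (hcontr x hx y hy).trans (mul_le_mul_of_nonneg_right hc.1.le (abs_nonneg _))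
  obtain ⟨c, hc, hmem⟩ :=
    ((eventually_all.2 hev).and (Ioo_mem_nhdsLT (zero_lt_one' ℝ))).exists
  exact ⟨c, hmem.1.le, hmem.2, hc⟩

theorem exists_uniform_holder (h : IFSHyp f g α d) :
    ∃ H, 0 ≤ H ∧ ∀ i, ∀ x ∈ Icc (0 : ℝ) 1, ∀ y ∈ Icc (0 : ℝ) 1,
      |deriv (f i) x - deriv (f i) y| ≤ H * |x - y| ^ α := by
  have hev : ∀ i, ∀ᶠ H in atTop, ∀ x ∈ Icc (0 : ℝ) 1, ∀ y ∈ Icc (0 : ℝ) 1,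
      |deriv (f i) x - deriv (f i) y| ≤ H * |x - y| ^ α := by
    intro i
    obtain ⟨H₀, hH₀⟩ := h.holder_f i
    filter_upwards [eventually_ge_atTop H₀] with H hH x hx y hy
    exact (hH₀ x hx y hy).trans
      (mul_le_mul_of_nonneg_right hH (Real.rpow_nonneg (abs_nonneg _) _))
  obtain ⟨H, hH, h0⟩ := ((eventually_all.2 hev).and (eventually_ge_atTop 0)).exists
  exact ⟨H, h0, hH⟩

theorem exists_uniform_bound (h : IFSHyp f g α d) :
    ∃ M, 0 < M ∧ ∀ i, ∀ a ∈ unitSq, |fderiv ℝ (g i) a (1, 0)| ≤ M := by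
  have hev : ∀ i, ∀ᶠ M in atTop, ∀ a ∈ unitSq, |fderiv ℝ (g i) a (1, 0)| ≤ M := by
    intro i
    obtain ⟨M₀, hM₀⟩ := h.exists_norm_fderiv_le i
    filter_upwards [eventually_ge_atTop M₀] with M hM a ha
    exact (abs_fderiv_apply_le (hM₀ a ha) (by simp [Prod.norm_def])).trans hM
  obtain ⟨M, hM, h0⟩ := ((eventually_all.2 hev).and (eventually_gt_atTop 0)).exists
  exact ⟨M, h0, hM⟩

end IFSHyp

theorem offdiagonal_bounded {ι : Type*} [Fintype ι]
    (f : ι → ℝ → ℝ) (g : ι → ℝ × ℝ → ℝ) (α d : ℝ) (h : IFSHyp f g α d) :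
    ∃ C : ℝ, 0 < C ∧ ∀ l : List ι, l ≠ [] → ∀ a ∈ unitSq, ∀ b ∈ unitSq,
      |gxw f g l a / fxw f g l b| ≤ C := by
  obtain ⟨η, hη1, hη⟩ := h.exists_uniform_domination
  obtain ⟨c, hc0, hc1, hc⟩ := h.exists_uniform_contraction
  obtain ⟨H, hH0, hH⟩ := h.exists_uniform_holder
  obtain ⟨M, hM0, hM⟩ := h.exists_uniform_bound
  have hlow : ∀ i, ∀ x ∈ Icc (0 : ℝ) 1, d ≤ deriv (f i) x := fun i x hx => h.le_deriv i hx
  have hd := h.d_pos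
  have hgap : 0 < 1 - η := sub_pos.2 hη1
  refine ⟨M / d / (1 - η) * Real.exp (H / d * (1 - c ^ α)⁻¹), by positivity,
    fun l _ a ha b hb => ?_⟩
  have hb0 := fxw_pos (g := g) hd h.diff_f h.maps_f hlow l hb
  rw [abs_div, abs_of_pos hb0, div_le_iff₀ hb0, mul_assoc]
  calc |gxw f g l a| ≤ M / d / (1 - η) * fxw f g l a :=
        abs_gxw_le_mul_fxw hd hη1 hM0.le h.diff_f h.diff_g h.maps_f h.maps_g hlow hM hη l ha
    _ ≤ _ := by
        gcongr
        exact fxw_le_exp_mul_fxw hd hc0 hc1 hH0 h.alpha_pos h.diff_f h.maps_f hlow hc hH l ha hb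

end
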